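/- arXiv:2309.13870 — 2 statements merged into one kernel-verified Lean document; each statement's English description precedes it below -/
import Mathlib

section
/- Let m,n ≥ 1 and let μ ⊆ m^n be a partition. Then, as an identity of rational functions in u over ℚ(α): T_{μ*μ̄}(u) = ∏_{b∈μ} (u−[b])/(u−[b̄]) · ∏_{b∈μ̄} (u−[v⁻ − h⁻_{μ̄}(b)])/(u−[v⁻ − h⁻_{m^n}(b̌)]) · ∏_{b∈μ} (u−[v⁻ + h⁺_{μ}(b)])/(u−[v⁻ + h⁺_{m^n}(b̂)]). -/
/-!
Common setup: boxes, Young diagrams as finite lower sets of boxes (French notation),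
arms, legs, hooks, the field `ℚ(α)`, rational functions in `u` over `ℚ(α)`,
the functions `T_Γ`, corners, star products, rectangles and complements.
-/

open scoped BigOperators

attribute [local instance] Classical.propDecidable

namespace JackLR

/-- A box `(x, y)`: `x` is the column index, `y` the row index (French notation). -/
abbrev Box := ℕ × ℕ

/-- The field `ℚ(α)`. -/
abbrev K := RatFunc ℚ

/-- Rational functions in a variable `u` with coefficients in `ℚ(α)`. -/
abbrev F := RatFunc K

/-- The indeterminate `α`. -/
noncomputable def alpha : K := RatFunc.X

/-- `[c] := α·x − y` for `c = (x, y) ∈ ℤ²`. -/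
noncomputable def brk (c : ℤ × ℤ) : K := alpha * (c.1 : K) - (c.2 : K)

/-- The embedding of a box into `ℤ²`. -/
def zb (b : Box) : ℤ × ℤ := ((b.1 : ℤ), (b.2 : ℤ))

/-- `[b]` for a box `b`. -/
noncomputable def brkN (b : Box) : K := brk (zb b)

/-- `S` is the set of boxes of a Young diagram (equivalently, of a partition). -/
def IsYoung (S : Finset Box) : Prop := IsLowerSet (↑S : Set Box)

/-- The arm of `s`: number of boxes of `S` strictly to the right of `s` in its row. -/
def arm (S : Finset Box) (s : Box) : ℕ := (S.filter fun b => b.2 = s.2 ∧ s.1 < b.1).card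

/-- The leg of `s`: number of boxes of `S` strictly above `s` in its column. -/
def leg (S : Finset Box) (s : Box) : ℕ := (S.filter fun b => b.1 = s.1 ∧ s.2 < b.2).card

/-- Upper hook vector `h⁺_S(s) = (arm+1, −leg)`. -/
def hup (S : Finset Box) (s : Box) : ℤ × ℤ := ((arm S s : ℤ) + 1, -(leg S s : ℤ))

/-- Lower hook vector `h⁻_S(s) = (arm, −leg−1)`. -/
def hlo (S : Finset Box) (s : Box) : ℤ × ℤ := ((arm S s : ℤ), -((leg S s : ℤ) + 1))

/-- Upper hook value `uh_S(s) = α(arm+1) + leg`. -/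
noncomputable def uh (S : Finset Box) (s : Box) : K := brk (hup S s)

/-- Lower hook value `lh_S(s) = α·arm + leg + 1`. -/
noncomputable def lh (S : Finset Box) (s : Box) : K := brk (hlo S s)

/-- The variable `u`. -/
noncomputable def uu : F := RatFunc.X

/-- `T_□(w) = (w−[0,0])(w−[1,1]) / ((w−[1,0])(w−[0,1]))`. -/
noncomputable def Tbox (w : F) : F :=
  ((w - RatFunc.C (brk (0, 0))) * (w - RatFunc.C (brk (1, 1)))) /
    ((w - RatFunc.C (brk (1, 0))) * (w - RatFunc.C (brk (0, 1))))

/-- `T_Γ` with the variable `u` replaced by `w`. -/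
noncomputable def TMat (Γ : Multiset Box) (w : F) : F :=
  (Γ.map fun b => Tbox (w - RatFunc.C (brkN b))).prod

/-- `T_Γ(u) = ∏_{b ∈ Γ} T_□(u − [b])` for a finite multiset `Γ` of boxes. -/
noncomputable def TM (Γ : Multiset Box) : F := TMat Γ uu

/-- `T_S(u)` for a finite set `S` of boxes. -/
noncomputable def TS (S : Finset Box) : F := TM S.val

/-- The star product `μ * ν` as the multiset `{s + t : s ∈ μ, t ∈ ν}` with multiplicity. -/
def star (μ ν : Finset Box) : Multiset Box :=
  μ.val.bind fun s => ν.val.map fun t => (s.1 + t.1, s.2 + t.2)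

/-- The rectangular partition `m^n` (n rows of length m). -/
def rect (m n : ℕ) : Finset Box := Finset.range m ×ˢ Finset.range n

/-- `v⁻ = (m−1, n−1)`. -/
def vminus (m n : ℕ) : Box := (m - 1, n - 1)

/-- `b̄ := v⁻ − b`. -/
def conjBox (m n : ℕ) (b : Box) : Box := (m - 1 - b.1, n - 1 - b.2)

/-- The complement partition of `μ ⊆ m^n` inside `m^n`, with boxes `{v⁻ − b : b ∈ m^n, b ∉ μ}`. -/
def complIn (m n : ℕ) (μ : Finset Box) : Finset Box := (rect m n \ μ).image (conjBox m n)

/-- `b̂ := (m−1−b₁, b₂)`. -/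
def hflip (m : ℕ) (b : Box) : Box := (m - 1 - b.1, b.2)

/-- `b̌ := (b₁, n−1−b₂)`. -/
def vflip (n : ℕ) (b : Box) : Box := (b.1, n - 1 - b.2)

/-- Inner corners `I_S`: removable boxes. -/
def Inner (S : Finset Box) : Finset Box :=
  S.filter fun s => (s.1 + 1, s.2) ∉ S ∧ (s.1, s.2 + 1) ∉ S

/-- `t` can be added to `S` to give again a Young diagram. -/
def addable (S : Finset Box) (t : Box) : Prop :=
  t ∉ S ∧ (t.1 = 0 ∨ (t.1 - 1, t.2) ∈ S) ∧ (t.2 = 0 ∨ (t.1, t.2 - 1) ∈ S)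

/-- Outer corners `O_S`: addable boxes (these all satisfy the bounds used below). -/
noncomputable def Outer (S : Finset Box) : Finset Box :=
  ((Finset.range (S.sup Prod.fst + 2)) ×ˢ (Finset.range (S.sup Prod.snd + 2))).filter
    fun t => addable S t

/-- `I⁺_S = {s + (1,1) : s ∈ I_S}`. -/
noncomputable def Iplus (S : Finset Box) : Finset Box :=
  (Inner S).image fun s => (s.1 + 1, s.2 + 1)

/-- `R^s_S` : boxes of `S` in the same row as `s`. -/
def rowOf (S : Finset Box) (s : Box) : Finset Box := S.filter fun b => b.2 = s.2

/-- `C^s_S` : boxes of `S` in the same column as `s`. -/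
def colOf (S : Finset Box) (s : Box) : Finset Box := S.filter fun b => b.1 = s.1

/-- `a ∧ b := (min a₁ b₁, min a₂ b₂)`. -/
def meet (a b : Box) : Box := (min a.1 b.1, min a.2 b.2)

/-- Pole order of `f` at `u = c`: multiplicity of `(u − c)` in the denominator minus its
multiplicity in the numerator, `f` being written in lowest terms. -/
noncomputable def polOrder (f : F) (c : K) : ℤ :=
  (f.denom.rootMultiplicity c : ℤ) - (f.num.rootMultiplicity c : ℤ)

/-- `ϖ_S = ∏_{b ∈ S, b ≠ (0,0)} [b]`. -/
noncomputable def varpi (S : Finset Box) : K := ∏ b ∈ S.erase (0, 0), brkN b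

section Numeric

variable {A : Type*} [AddCommGroup A]

/-- A discrete antiderivative in the first variable. -/
lemma exists_antideriv (φ : ℤ → ℤ → A) :
    ∃ ψ : ℤ → ℤ → A, ∀ a b, 0 ≤ a → φ a b = ψ (a + 1) b - ψ a b := by
  refine ⟨fun a b => ∑ i ∈ Finset.range a.toNat, φ i b, fun a b ha => ?_⟩
  lift a to ℕ using ha
  have h : ((a : ℤ) + 1).toNat = a + 1 := by omega
  simp [h, Finset.sum_range_succ]

lemma sum_Ico_add_eq {φ ψ : ℤ → ℤ → A} (h : ∀ a b, 0 ≤ a → φ a b = ψ (a + 1) b - ψ a b)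
    (c b : ℤ) (hc : 0 ≤ c) (p : ℕ) :
    ∑ i ∈ Finset.range p, φ (c + i) b = ψ (c + p) b - ψ c b := by
  induction p with
  | zero => simp
  | succ p ih =>
    rw [Finset.sum_range_succ, ih, h _ _ (by positivity)]
    push_cast
    rw [add_assoc c]
    abel

lemma sum_Ico_sub_eq {φ ψ : ℤ → ℤ → A} (h : ∀ a b, 0 ≤ a → φ a b = ψ (a + 1) b - ψ a b)
    (c b : ℤ) (p q : ℕ) (hpq : p ≤ q) (hc : (q : ℤ) ≤ c) :
    ∑ i ∈ Finset.Ico p q, φ (c - 1 - i) b = ψ (c - p) b - ψ (c - q) b := by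
  induction q, hpq using Nat.le_induction with
  | base => simp
  | succ q hq ih =>
    push_cast at hc
    rw [Finset.sum_Ico_succ_top hq, ih (by omega), h _ _ (by omega)]
    push_cast
    rw [show c - 1 - (q : ℤ) + 1 = c - q by ring, show c - ((q : ℤ) + 1) = c - 1 - q by ring]
    abel

lemma sum_Ico_succ_shift (f g : ℕ → A) {j n : ℕ} (h : j ≤ n) :
    ∑ k ∈ Finset.Ico j n, (f k - g (k + 1)) =
      ∑ k ∈ Finset.Ico j n, (f k - g k) + g j - g n := by
  induction n, h using Nat.le_induction with
  | base => simp
  | succ n hn ih =>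
    rw [Finset.sum_Ico_succ_top hn, Finset.sum_Ico_succ_top hn, ih]
    abel

lemma sum_Ico_reflect_triangle (D : ℕ → ℕ → A) (n : ℕ) :
    ∑ j ∈ Finset.range n, ∑ k ∈ Finset.Ico j n, D (n - 1 - j) (n - 1 - k) =
      ∑ j ∈ Finset.range n, ∑ k ∈ Finset.range (j + 1), D j k := by
  rw [← Finset.sum_range_reflect]
  refine Finset.sum_congr rfl fun j hj => ?_
  have hj := Finset.mem_range.1 hj
  rw [Finset.sum_Ico_eq_sum_range, ← Finset.sum_range_reflect]
  refine Finset.sum_congr (by congr 1; omega) fun k hk => ?_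
  have hk := Finset.mem_range.1 hk
  congr 1 <;> omega

lemma sum_triangles (D : ℕ → ℕ → A) (n : ℕ) :
    ∑ j ∈ Finset.range n, ∑ k ∈ Finset.Ico j n, D j k +
      ∑ j ∈ Finset.range n, ∑ k ∈ Finset.range (j + 1), D j k =
    ∑ j ∈ Finset.range n, ∑ k ∈ Finset.range n, D j k + ∑ j ∈ Finset.range n, D j j := by
  simp only [← Finset.sum_add_distrib]
  refine Finset.sum_congr rfl fun j hj => ?_
  rw [Finset.sum_range_succ, ← Finset.sum_range_add_sum_Ico (D j) (Finset.mem_range.1 hj).le]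
  abel

/-- The quadrant decomposition after summation along rows: `a` and `r` are the row lengths
of a partition and of its complement. -/
lemma row_identity (ψ : ℤ → ℤ → A) (m : ℤ) (n : ℕ) (a r : ℕ → ℤ) (ha : a n = 0) (hr : r n = 0)
    (har : ∀ k < n, r k = m - a (n - 1 - k)) :
    ∑ j ∈ Finset.range n, ∑ k ∈ Finset.range n,
      ((ψ (r k) (j + k) - ψ 0 (j + k) - ψ (a j + r k) (j + k) + ψ (a j) (j + k)) -
       (ψ (r k) (j + k + 1) - ψ 0 (j + k + 1) - ψ (a j + r k) (j + k + 1)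
         + ψ (a j) (j + k + 1))) =
    (∑ j ∈ Finset.range n, (ψ (a j) j - ψ 0 j)
      - ∑ j ∈ Finset.range n, (ψ m (n - 1 - j) - ψ (m - a j) (n - 1 - j)))
    + (∑ j ∈ Finset.range n, ∑ k ∈ Finset.Ico j n,
        (ψ (m - r j + r k) (n + k - j) - ψ (m - r j + r (k + 1)) (n + k - j))
      - ∑ k ∈ Finset.range n, (ψ (r k) (n + k) - ψ 0 (n + k)))
    + (∑ j ∈ Finset.range n, ∑ k ∈ Finset.Ico j n,
        (ψ (m + a j - a (k + 1)) (n - 1 - k + j) - ψ (m + a j - a k) (n - 1 - k + j))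
      - ∑ j ∈ Finset.range n, (ψ (m + a j) j - ψ m j)) := by
  set D : ℕ → ℕ → A := fun j k =>
    ψ (m + a j - a k) (n - k + j) - ψ (m + a j - a k) (n - 1 - k + j) with hD
  have tel : ∀ (x c : ℤ), ∑ k ∈ Finset.range n, (ψ x (c + k) - ψ x (c + k + 1)) =
      ψ x c - ψ x (c + n) := by
    intro x c
    have := Finset.sum_range_sub' (fun k : ℕ => ψ x (c + k)) n
    simpa [add_assoc] using this
  have third : ∑ j ∈ Finset.range n, ∑ k ∈ Finset.Ico j n,
      (ψ (m + a j - a (k + 1)) (n - 1 - k + j) - ψ (m + a j - a k) (n - 1 - k + j)) =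
      ∑ j ∈ Finset.range n, ∑ k ∈ Finset.Ico j n, D j k
        + ∑ j ∈ Finset.range n, (ψ (m + a j) j - ψ m n) := by
    rw [← Finset.sum_add_distrib]
    refine Finset.sum_congr rfl fun j hj => ?_
    have h := sum_Ico_succ_shift (fun k : ℕ => ψ (m + a j - a k) (n - 1 - k + j))
      (fun k : ℕ => ψ (m + a j - a k) (n - k + j)) (Finset.mem_range.1 hj).le
    rw [← neg_inj, ← Finset.sum_neg_distrib, neg_add, ← Finset.sum_neg_distrib]
    simp only [hD, neg_sub, ha, sub_zero, add_sub_cancel_right, sub_self, zero_add,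
      sub_add_cancel] at h ⊢
    rw [← add_sub_assoc, ← h]
    refine Finset.sum_congr rfl fun k _ => ?_
    push_cast
    rw [show (n : ℤ) - (k + 1) + j = n - 1 - k + j by ring]
  have second : ∑ j ∈ Finset.range n, ∑ k ∈ Finset.Ico j n,
      (ψ (m - r j + r k) (n + k - j) - ψ (m - r j + r (k + 1)) (n + k - j)) =
      ∑ j ∈ Finset.range n, ∑ k ∈ Finset.range (j + 1), D j k
        + ∑ j ∈ Finset.range n, (ψ m (n - 1) - ψ (a j) (n + j)) := by
    rw [← sum_Ico_reflect_triangle, ← Finset.sum_range_reflect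
      (fun j : ℕ => ψ m (n - 1) - ψ (a j) (n + j)), ← Finset.sum_add_distrib]
    refine Finset.sum_congr rfl fun j hj => ?_
    have hj := Finset.mem_range.1 hj
    have h := sum_Ico_succ_shift (fun k : ℕ => ψ (m - r j + r k) (n + k - j))
      (fun k : ℕ => ψ (m - r j + r k) (n - 1 + k - j)) hj.le
    have e1 : m - r j + r n = a (n - 1 - j) := by rw [hr, har j hj]; ring
    have e2 : (n : ℤ) - 1 + n - j = n + (n - 1 - j : ℕ) := by omega
    rw [e1, e2, sub_add_cancel, add_sub_cancel_right] at h
    rw [← add_sub_assoc]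
    convert h using 1
    · refine Finset.sum_congr rfl fun k _ => ?_
      push_cast
      rw [show (n : ℤ) - 1 + (k + 1) - j = n + k - j by ring]
    · congr 2
      refine Finset.sum_congr rfl fun k hk => ?_
      have hk := Finset.mem_Ico.1 hk
      simp only [hD]
      rw [har j hj, har k hk.2,
        show m + a (n - 1 - j) - a (n - 1 - k) = m - (m - a (n - 1 - j)) + (m - a (n - 1 - k)) by
          ring,
        show (n : ℤ) - (n - 1 - k : ℕ) + (n - 1 - j : ℕ) = n + k - j by omega,
        show (n : ℤ) - 1 - (n - 1 - k : ℕ) + (n - 1 - j : ℕ) = n - 1 + k - j by omega]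
  have main : ∑ j ∈ Finset.range n, ∑ k ∈ Finset.range n,
      (ψ (a j + r k) (j + k + 1) - ψ (a j + r k) (j + k)) =
      ∑ j ∈ Finset.range n, ∑ k ∈ Finset.range n, D j k := by
    refine Finset.sum_congr rfl fun j _ => ?_
    rw [← Finset.sum_range_reflect (D j)]
    refine Finset.sum_congr rfl fun k hk => ?_
    have hk := Finset.mem_range.1 hk
    simp only [hD]
    rw [har k hk, show m + a j - a (n - 1 - k) = a j + (m - a (n - 1 - k)) by ring,
      show (n : ℤ) - (n - 1 - k : ℕ) + j = j + k + 1 by omega,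
      show (n : ℤ) - 1 - (n - 1 - k : ℕ) + j = j + k by omega]
  have conj : ∑ j ∈ Finset.range n, (ψ m (n - 1 - j) - ψ (m - a j) (n - 1 - j)) =
      ∑ k ∈ Finset.range n, (ψ m k - ψ (r k) k) := by
    rw [← Finset.sum_range_reflect]
    refine Finset.sum_congr rfl fun k hk => ?_
    have hk := Finset.mem_range.1 hk
    rw [har k hk, show (n : ℤ) - 1 - (n - 1 - k : ℕ) = k by omega]
  have diag : ∑ j ∈ Finset.range n, D j j = ∑ j ∈ Finset.range n, (ψ m n - ψ m (n - 1)) := by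
    simp [hD]
  have lhs : ∑ j ∈ Finset.range n, ∑ k ∈ Finset.range n,
      ((ψ (r k) (j + k) - ψ 0 (j + k) - ψ (a j + r k) (j + k) + ψ (a j) (j + k)) -
       (ψ (r k) (j + k + 1) - ψ 0 (j + k + 1) - ψ (a j + r k) (j + k + 1)
         + ψ (a j) (j + k + 1))) =
      ∑ k ∈ Finset.range n, (ψ (r k) k - ψ (r k) (k + n))
      - ∑ j ∈ Finset.range n, (ψ 0 j - ψ 0 (j + n))
      + ∑ j ∈ Finset.range n, (ψ (a j) j - ψ (a j) (j + n))
      + ∑ j ∈ Finset.range n, ∑ k ∈ Finset.range n, D j k := by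
    simp only [← main, ← tel]
    rw [Finset.sum_comm (f := fun k l : ℕ => ψ (r k) (k + l) - ψ (r k) (k + l + 1))]
    simp only [← Finset.sum_sub_distrib, ← Finset.sum_add_distrib]
    refine Finset.sum_congr rfl fun j _ => Finset.sum_congr rfl fun k _ => ?_
    rw [add_comm (k : ℤ) j]
    abel
  have tri := sum_triangles D n
  rw [diag] at tri
  rw [lhs, third, second, conj, eq_sub_of_add_eq tri.symm]
  simp only [add_comm (n : ℤ), Finset.sum_sub_distrib]
  abel

end Numeric

section Rows

/-- `r` lists the row lengths of the Young diagram `S`. -/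
def HasRows (S : Finset Box) (r : ℕ → ℕ) : Prop :=
  Antitone r ∧ ∀ i j, (i, j) ∈ S ↔ i < r j

lemma IsYoung.exists_hasRows {S : Finset Box} (hS : IsYoung S) : ∃ r, HasRows S r := by
  have hex : ∀ j, ∃ i, (i, j) ∉ S := fun j => by
    by_contra! h
    exact Set.infinite_univ.not_finite ((S.finite_toSet.preimage
      (f := fun i : ℕ => ((i, j) : Box)) (by intro a _ b _ h; simpa using h)).subset
        fun i _ => h i)
  have hmem : ∀ i j, (i, j) ∈ S ↔ i < Nat.find (hex j) := fun i j => by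
    rw [Nat.lt_find_iff]
    constructor
    · intro h k hk
      simpa using hS (show ((k, j) : Box) ≤ (i, j) from ⟨hk, le_rfl⟩) h
    · intro h
      simpa using h i le_rfl
  refine ⟨_, fun j k hjk => ?_, hmem⟩
  by_contra! h
  have hk := (hmem _ k).2 h
  have hj : (Nat.find (hex j), j) ∈ S := hS (show ((_, j) : Box) ≤ (_, k) from ⟨le_rfl, hjk⟩) hk
  exact Nat.find_spec (hex j) hj

namespace HasRows

variable {S : Finset Box} {r : ℕ → ℕ}

lemma arm_eq (h : HasRows S r) (i j : ℕ) : arm S (i, j) = r j - 1 - i := by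
  have : (S.filter fun b => b.2 = (i, j).2 ∧ (i, j).1 < b.1) =
      (Finset.Ioo i (r j)).image fun x => (x, j) := by
    ext ⟨x, y⟩
    simp only [Finset.mem_filter, h.2, Finset.mem_image, Finset.mem_Ioo, Prod.mk.injEq]
    constructor
    · rintro ⟨h1, rfl, h2⟩
      exact ⟨x, ⟨h2, h1⟩, rfl, rfl⟩
    · rintro ⟨_, ⟨h1, h2⟩, rfl, rfl⟩
      exact ⟨h2, rfl, h1⟩
  rw [arm, this, Finset.card_image_of_injective _ (Prod.mk_left_injective j), Nat.card_Ioo]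
  omega

lemma leg_eq (h : HasRows S r) {i j k : ℕ} (h1 : r (k + 1) ≤ i) (h2 : i < r k) :
    leg S (i, j) = k - j := by
  have : (S.filter fun b => b.1 = (i, j).1 ∧ (i, j).2 < b.2) =
      (Finset.Ioc j k).image fun y => (i, y) := by
    ext ⟨x, y⟩
    simp only [Finset.mem_filter, h.2, Finset.mem_image, Finset.mem_Ioc, Prod.mk.injEq]
    constructor
    · rintro ⟨h3, rfl, h4⟩
      refine ⟨y, ⟨h4, ?_⟩, rfl, rfl⟩
      by_contra! hy
      exact absurd (h.1 (show k + 1 ≤ y from hy)) (by omega)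
    · rintro ⟨_, ⟨h3, h4⟩, rfl, rfl⟩
      exact ⟨h2.trans_le (h.1 h4), rfl, h3⟩
  rw [leg, this, Finset.card_image_of_injective _ (Prod.mk_right_injective i), Nat.card_Ioc]

variable {A : Type*} [AddCommGroup A]

lemma sum_eq (h : HasRows S r) {N : ℕ} (hN : r N = 0) (f : Box → A) :
    ∑ b ∈ S, f b = ∑ j ∈ Finset.range N, ∑ i ∈ Finset.range (r j), f (i, j) := by
  refine Finset.sum_finset_product_right' S _ (fun j => Finset.range (r j))
    (f := fun i j => f (i, j))
    fun ⟨x, y⟩ => ?_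
  simp only [h.2, Finset.mem_range]
  refine ⟨fun hx => ⟨?_, hx⟩, And.right⟩
  by_contra! hy
  exact absurd (h.1 hy) (by omega)

lemma sum_range_eq (hr : Antitone r) {j N : ℕ} (hj : j ≤ N) (f : ℕ → A) :
    ∑ k ∈ Finset.Ico j N, ∑ i ∈ Finset.Ico (r (k + 1)) (r k), f i =
      ∑ i ∈ Finset.Ico (r N) (r j), f i := by
  induction N, hj using Nat.le_induction with
  | base => simp
  | succ N hN ih =>
    rw [Finset.sum_Ico_succ_top hN, ih, add_comm,
      Finset.sum_Ico_consecutive _ (hr N.le_succ) (hr hN)]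

/-- Sums over boxes of functions of the arm and leg, grouped by the row of the box and the
topmost row of its column. -/
lemma sum_arm_leg (h : HasRows S r) {N : ℕ} (hN : r N = 0) (f : ℕ → ℕ → A) :
    ∑ b ∈ S, f (arm S b) (leg S b) = ∑ j ∈ Finset.range N, ∑ k ∈ Finset.Ico j N,
      ∑ i ∈ Finset.Ico (r (k + 1)) (r k), f (r j - 1 - i) (k - j) := by
  rw [h.sum_eq hN]
  refine Finset.sum_congr rfl fun j hj => ?_
  rw [Finset.range_eq_Ico, ← hN, ← sum_range_eq h.1 (Finset.mem_range.1 hj).le]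
  refine Finset.sum_congr rfl fun k _ => Finset.sum_congr rfl fun i hi => ?_
  have hi := Finset.mem_Ico.1 hi
  rw [h.arm_eq, h.leg_eq hi.1 hi.2]

end HasRows

lemma hasRows_rect (m n : ℕ) : HasRows (rect m n) fun j => if j < n then m else 0 := by
  refine ⟨fun j k hjk => ?_, fun i j => ?_⟩
  · dsimp only
    split_ifs <;> omega
  · simp only [rect, Finset.mem_product, Finset.mem_range]
    split_ifs <;> omega

lemma arm_rect {m n i j : ℕ} (hj : j < n) : arm (rect m n) (i, j) = m - 1 - i := by
  simp [(hasRows_rect m n).arm_eq, hj]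

lemma leg_rect {m n i j : ℕ} (hi : i < m) (hj : j < n) : leg (rect m n) (i, j) = n - 1 - j :=
  (hasRows_rect m n).leg_eq (k := n - 1)
    (by simp [show ¬ n - 1 + 1 < n by omega]) (by simpa [show n - 1 < n by omega] using hi)

lemma HasRows.complIn {μ : Finset Box} {a : ℕ → ℕ} (h : HasRows μ a) (m n : ℕ) :
    HasRows (complIn m n μ) fun k => if k < n then m - a (n - 1 - k) else 0 := by
  refine ⟨fun j k hjk => ?_, fun i j => ?_⟩
  · dsimp only
    have := h.1 (show n - 1 - k ≤ n - 1 - j by omega)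
    split_ifs <;> omega
  · simp only [JackLR.complIn, rect, conjBox, Finset.mem_image, Finset.mem_sdiff,
      Finset.mem_product, Finset.mem_range, Prod.exists, h.2, Prod.mk.injEq]
    constructor
    · rintro ⟨x, y, ⟨⟨hx, hy⟩, hxy⟩, rfl, rfl⟩
      rw [if_pos (by omega), show n - 1 - (n - 1 - y) = y by omega]
      omega
    · split_ifs with hj
      · intro hi
        exact ⟨m - 1 - i, n - 1 - j, by omega, by omega, by omega⟩
      · intro hi
        omega

variable {A : Type*} [AddCommGroup A]

/-- The quadrant decomposition for sums of an arbitrary function on the lattice. -/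
lemma quadrant_sum (φ : ℤ → ℤ → A) (m n : ℕ) (μ : Finset Box)
    (hμ : IsYoung μ) (hsub : μ ⊆ rect m n) :
    ∑ s ∈ μ, ∑ t ∈ complIn m n μ,
      ((φ (s.1 + t.1) (s.2 + t.2) - φ (s.1 + t.1 + 1) (s.2 + t.2)) -
        (φ (s.1 + t.1) (s.2 + t.2 + 1) - φ (s.1 + t.1 + 1) (s.2 + t.2 + 1))) =
    (∑ b ∈ μ, φ b.1 b.2 - ∑ b ∈ μ, φ (m - 1 - b.1) (n - 1 - b.2)) +
    (∑ b ∈ complIn m n μ,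
        φ (m - 1 - arm (complIn m n μ) b) (n + leg (complIn m n μ) b) -
      ∑ b ∈ complIn m n μ, φ b.1 (n + b.2)) +
    (∑ b ∈ μ, φ (m + arm μ b) (n - 1 - leg μ b) - ∑ b ∈ μ, φ (m + b.1) b.2) := by
  obtain ⟨ψ, hψ⟩ := exists_antideriv φ
  obtain ⟨a, ha⟩ := hμ.exists_hasRows
  have hν := ha.complIn m n
  set r : ℕ → ℕ := fun k => if k < n then m - a (n - 1 - k) else 0
  have an : a n = 0 := by
    by_contra h
    have := hsub ((ha.2 0 n).2 (by omega))
    simp [rect] at this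
  have am : ∀ j, a j ≤ m := fun j => by
    by_contra! h
    have := hsub ((ha.2 m j).2 h)
    simp [rect] at this
  have rn : r n = 0 := by simp [r]
  have rm : ∀ k, r k ≤ m := fun k => by simp only [r]; split_ifs <;> omega
  have key := row_identity ψ m n (fun j => a j) (fun j => r j) (by simp [an]) (by simp [rn])
    fun k hk => by
      have := am (n - 1 - k)
      simp only [r, if_pos hk]
      omega
  beta_reduce at key
  have s1 := sum_Ico_add_eq hψ
  have lhs_row : ∀ (p q : ℕ) (y : ℤ), ∑ i ∈ Finset.range p, ∑ i' ∈ Finset.range q,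
      (φ (i + i') y - φ (i + i' + 1) y) = ψ q y - ψ 0 y - ψ (p + q) y + ψ p y := by
    intro p q y
    have h0 := s1 0 y le_rfl q
    have hp := s1 p y (by positivity) q
    simp only [zero_add] at h0
    rw [Finset.sum_comm]
    have : ∀ i' : ℕ, ∑ i ∈ Finset.range p, (φ (i + i') y - φ (i + i' + 1) y) =
        φ i' y - φ (p + i') y := fun i' => by
      have := Finset.sum_range_sub' (fun i : ℕ => φ (i + i') y) p
      simpa [add_right_comm] using this
    simp only [this, Finset.sum_sub_distrib, h0, hp]
    abel
  convert key using 1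
  · rw [ha.sum_eq an]
    refine Finset.sum_congr rfl fun j _ => ?_
    simp only [hν.sum_eq rn]
    rw [Finset.sum_comm]
    refine Finset.sum_congr rfl fun k _ => ?_
    rw [← lhs_row, ← lhs_row]
    simp only [← Finset.sum_sub_distrib]
  · congr 1
    · congr 1
      · congr 1
        · rw [ha.sum_eq an]
          refine Finset.sum_congr rfl fun j _ => ?_
          simpa using s1 0 j le_rfl (a j)
        · rw [ha.sum_eq an]
          refine Finset.sum_congr rfl fun j _ => ?_
          have := sum_Ico_sub_eq hψ m (n - 1 - j) 0 (a j) (Nat.zero_le _) (by exact_mod_cast am j)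
          simpa using this
      · congr 1
        · rw [hν.sum_arm_leg rn fun x y => φ (m - 1 - x) (n + y)]
          refine Finset.sum_congr rfl fun j _ => Finset.sum_congr rfl fun k hk => ?_
          have hk := Finset.mem_Ico.1 hk
          have h1 := hν.1 (show k ≤ k + 1 by omega)
          have h2 := hν.1 hk.1
          have h3 := rm j
          have := Finset.sum_Ico_eq_sum_range (fun i : ℕ => φ (m - r j + i) (n + k - j))
            (r (k + 1)) (r k)
          have h4 := s1 (m - r j + r (k + 1)) (n + k - j) (by omega) (r k - r (k + 1))
          rw [show (m : ℤ) - r j + r (k + 1) + (r k - r (k + 1) : ℕ) = m - r j + r k by omega] at h4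
          rw [← h4]
          push_cast at this
          simp only [add_assoc] at this ⊢
          rw [← this]
          refine Finset.sum_congr rfl fun i hi => ?_
          have hi := Finset.mem_Ico.1 hi
          congr 1 <;> omega
        · rw [hν.sum_eq rn]
          refine Finset.sum_congr rfl fun j _ => ?_
          simpa using s1 0 (n + j) le_rfl (r j)
    · congr 1
      · rw [ha.sum_arm_leg an fun x y => φ (m + x) (n - 1 - y)]
        refine Finset.sum_congr rfl fun j _ => Finset.sum_congr rfl fun k hk => ?_
        have hk := Finset.mem_Ico.1 hk
        have h1 := ha.1 (show k ≤ k + 1 by omega)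
        have h2 := ha.1 hk.1
        rw [← sum_Ico_sub_eq hψ _ _ _ _ h1 (by have := am k; omega)]
        refine Finset.sum_congr rfl fun i hi => ?_
        have hi := Finset.mem_Ico.1 hi
        congr 1 <;> omega
      · rw [ha.sum_eq an]
        refine Finset.sum_congr rfl fun j _ => ?_
        simpa using s1 m j (by positivity) (a j)

end Rows

section Factors

lemma uu_sub_C_ne_zero (c : K) : uu - RatFunc.C c ≠ 0 := by
  rw [uu, ← RatFunc.algebraMap_X, ← RatFunc.algebraMap_C, ← map_sub]
  exact RatFunc.algebraMap_ne_zero (Polynomial.X_sub_C_ne_zero c)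

/-- The factor `u − [(a, b)]`, as an element of the unit group written additively. -/
noncomputable def factor (a b : ℤ) : Additive Fˣ :=
  Additive.ofMul (Units.mk0 (uu - RatFunc.C (brk (a, b))) (uu_sub_C_ne_zero _))

/-- The value in `F` of an element of the additive unit group. -/
noncomputable def val (g : Additive Fˣ) : F := (g.toMul : Fˣ)

lemma val_add (g h : Additive Fˣ) : val (g + h) = val g * val h := by simp [val]

lemma val_sub (g h : Additive Fˣ) : val (g - h) = val g / val h := by simp [val]

lemma val_sum {ι : Type*} (s : Finset ι) (f : ι → Additive Fˣ) :
    val (∑ i ∈ s, f i) = ∏ i ∈ s, val (f i) := by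
  simp [val, toMul_sum]

lemma val_factor (a b : ℤ) : val (factor a b) = uu - RatFunc.C (brk (a, b)) := rfl

lemma uu_sub_sub (c d : ℤ × ℤ) :
    uu - RatFunc.C (brk c) - RatFunc.C (brk d) = uu - RatFunc.C (brk (c + d)) := by
  rw [sub_sub, ← map_add]
  simp only [brk, Prod.fst_add, Prod.snd_add, Int.cast_add]
  ring_nf

lemma Tbox_eq (b : Box) : Tbox (uu - RatFunc.C (brkN b)) =
    val ((factor b.1 b.2 - factor (b.1 + 1) b.2) -
      (factor b.1 (b.2 + 1) - factor (b.1 + 1) (b.2 + 1))) := by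
  simp only [Tbox, brkN, uu_sub_sub, val_sub, val_factor, zb, Prod.mk_add_mk, add_zero]
  rw [div_div_div_eq]

lemma TM_star (μ ν : Finset Box) : TM (star μ ν) =
    ∏ s ∈ μ, ∏ t ∈ ν, Tbox (uu - RatFunc.C (brkN (s.1 + t.1, s.2 + t.2))) := by
  simp only [TM, TMat, star, Multiset.map_bind, Multiset.prod_bind, Multiset.map_map]
  rfl

end Factors

/-- The quadrant decomposition of `T_{μ*μ̄}` for `μ ⊆ m^n`. -/
theorem stmt0 (m n : ℕ) (hm : 1 ≤ m) (hn : 1 ≤ n) (μ : Finset Box)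
    (hμ : IsYoung μ) (hsub : μ ⊆ rect m n) :
    TM (star μ (complIn m n μ)) =
      (∏ b ∈ μ, (uu - RatFunc.C (brkN b)) / (uu - RatFunc.C (brkN (conjBox m n b)))) *
        (∏ b ∈ complIn m n μ,
          (uu - RatFunc.C (brk (zb (vminus m n) - hlo (complIn m n μ) b))) /
            (uu - RatFunc.C (brk (zb (vminus m n) - hlo (rect m n) (vflip n b))))) *
        (∏ b ∈ μ,
          (uu - RatFunc.C (brk (zb (vminus m n) + hup μ b))) /
            (uu - RatFunc.C (brk (zb (vminus m n) + hup (rect m n) (hflip m b))))) := by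
  have key := congrArg val (quadrant_sum factor m n μ hμ hsub)
  simp only [val_add, val_sub, val_sum, val_factor] at key
  simp only [TM_star, Tbox_eq, val_sub, val_factor, Nat.cast_add]
  rw [key]
  simp only [Finset.prod_div_distrib]
  have hrect : ∀ b ∈ μ, b.1 < m ∧ b.2 < n := fun b hb => by simpa [rect] using hsub hb
  have hcompl : ∀ b ∈ complIn m n μ, b.1 < m ∧ b.2 < n := fun b hb => by
    simp only [complIn, rect, conjBox, Finset.mem_image, Finset.mem_sdiff, Finset.mem_product,
      Finset.mem_range] at hb
    obtain ⟨c, -, rfl⟩ := hb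
    dsimp only
    omega
  congr 1
  · congr 1
    · congr 1
      refine Finset.prod_congr rfl fun b hb => ?_
      have := hrect b hb
      congr 3
      ext <;> simp only [zb, conjBox] <;> omega
    · congr 1
      · refine Finset.prod_congr rfl fun b _ => ?_
        congr 3
        ext <;> simp only [zb, vminus, hlo, Prod.fst_sub, Prod.snd_sub] <;> omega
      · refine Finset.prod_congr rfl fun b hb => ?_
        have := hcompl b hb
        congr 3
        ext <;> simp only [zb, vminus, hlo, vflip, Prod.fst_sub, Prod.snd_sub]
        · rw [arm_rect (by omega)]
          omega
        · rw [leg_rect (by omega) (by omega)]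
          omega
  · congr 1
    · refine Finset.prod_congr rfl fun b _ => ?_
      congr 3
      ext <;> simp only [zb, vminus, hup, Prod.fst_add, Prod.snd_add] <;> omega
    · refine Finset.prod_congr rfl fun b hb => ?_
      have := hrect b hb
      congr 3
      ext <;> simp only [zb, vminus, hup, hflip, Prod.fst_add, Prod.snd_add]
      · rw [arm_rect (by omega)]
        omega
      · rw [leg_rect (by omega) (by omega)]
        omega

end JackLR
end

section
/- Let m,n ≥ 1 and let μ ⊆ m^n be a partition. For a partition σ ⊆ m^n define D'_σ(b) := lh_{m^n}(b) if b̌ ∈ σ and D'_σ(b) := uh_{m^n}(b) otherwise. Then the following identity holds in ℚ(α): (∏_{b∈μ} lh_μ(b)) · (∏_{b∈μ̄} uh_{μ̄}(b)) · (∏_{b∈m^n} D'_{μ̄}(b)) = (∏_{b∈μ} uh_μ(b)) · (∏_{b∈μ̄} lh_{μ̄}(b)) · (∏_{b∈m^n} D'_{μ}(b)). Equivalently, the two hook-product presentations ∏_{b∈μ}lh_μ(b)∏_{b∈μ̄}uh_{μ̄}(b) / ∏_{b∈m^n}D'_{μ}(b) and ∏_{b∈μ}uh_μ(b)∏_{b∈μ̄}lh_{μ̄}(b)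 / ∏_{b∈m^n}D'_{μ̄}(b) of the rectangular Littlewood–Richardson coefficient are equal. -/
/-!
Common setup: boxes, Young diagrams as finite lower sets of boxes (French notation),
arms, legs, hooks, the field `ℚ(α)`, rational functions in `u` over `ℚ(α)`,
the functions `T_Γ`, corners, star products, rectangles and complements.
-/

open scoped BigOperators

attribute [local instance] Classical.propDecidable

namespace JackLR

/-- `D'_σ(b)` relative to the rectangle `m^n`. -/
noncomputable def Dp (m n : ℕ) (σ : Finset Box) (b : Box) : K :=
  if vflip n b ∈ σ then lh (rect m n) b else uh (rect m n) b

/-- The monomial `t^v` of the group ring `ℤ[ℤ²]`. -/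
noncomputable def mono (v : ℤ × ℤ) : AddMonoidAlgebra ℤ (ℤ × ℤ) := AddMonoidAlgebra.single v 1

lemma mono_mul (v w : ℤ × ℤ) : mono v * mono w = mono (v + w) := by
  simp [mono, AddMonoidAlgebra.single_mul_single]

lemma mono_zero : mono 0 = 1 := rfl

/-- The involution `t^v ↦ t^{-v}` of `ℤ[ℤ²]`. -/
noncomputable def monoInv : AddMonoidAlgebra ℤ (ℤ × ℤ) →+* AddMonoidAlgebra ℤ (ℤ × ℤ) :=
  AddMonoidAlgebra.mapDomainRingHom ℤ negAddMonoidHom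

lemma monoInv_mono (v : ℤ × ℤ) : monoInv (mono v) = mono (-v) := by
  simp [monoInv, mono]

lemma monoInv_monoInv (X : AddMonoidAlgebra ℤ (ℤ × ℤ)) : monoInv (monoInv X) = X := by
  induction X using AddMonoidAlgebra.induction_on with
  | of v =>
    change monoInv (monoInv (mono v)) = mono v
    rw [monoInv_mono, monoInv_mono, neg_neg]
  | add x y hx hy => simp only [map_add, hx, hy]
  | smul r x hx => simp only [map_zsmul, hx]

/-- The group homomorphism from `ℤ[ℤ²]` determined by the images of the monomials. -/
noncomputable def monoLift {M : Type*} [CommGroup M] (G : ℤ × ℤ → M) :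
    AddMonoidAlgebra ℤ (ℤ × ℤ) →+ Additive M :=
  (Finsupp.liftAddHom fun v => zmultiplesHom (Additive M) (Additive.ofMul (G v))).comp
    AddMonoidAlgebra.coeffAddEquiv.toAddMonoidHom

lemma monoLift_mono {M : Type*} [CommGroup M] (G : ℤ × ℤ → M) (v : ℤ × ℤ) :
    monoLift G (mono v) = Additive.ofMul (G v) := by
  simp [monoLift, mono]

lemma monoLift_monoInv {M : Type*} [CommGroup M] {G : ℤ × ℤ → M} (hG : ∀ v, G (-v) = G v)
    (X : AddMonoidAlgebra ℤ (ℤ × ℤ)) : monoLift G (monoInv X) = monoLift G X := by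
  induction X using AddMonoidAlgebra.induction_on with
  | of v =>
    change monoLift G (monoInv (mono v)) = monoLift G (mono v)
    rw [monoInv_mono, monoLift_mono, monoLift_mono, hG]
  | add x y hx hy => simp only [map_add, hx, hy]
  | smul r x hx => simp only [map_zsmul, hx]

/-- Two products of values of an even function agree as soon as the formal sums of their arguments
differ by an antisymmetric element. -/
lemma prod_eq_of_sum_mono {M ι : Type*} [CommGroup M] {G : ℤ × ℤ → M} (hG : ∀ v, G (-v) = G v)
    (s : Finset ι) (f f' g g' : ι → ℤ × ℤ) (X : AddMonoidAlgebra ℤ (ℤ × ℤ))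
    (h : (∑ i ∈ s, mono (f i) + ∑ i ∈ s, mono (f' i)) -
      (∑ i ∈ s, mono (g i) + ∑ i ∈ s, mono (g' i)) = X - monoInv X) :
    (∏ i ∈ s, G (f i)) * ∏ i ∈ s, G (f' i) = (∏ i ∈ s, G (g i)) * ∏ i ∈ s, G (g' i) := by
  have h' := congrArg (monoLift G) h
  rw [map_sub, map_sub, monoLift_monoInv hG, sub_self, sub_eq_zero] at h'
  simp only [map_add, map_sum, monoLift_mono] at h'
  exact h'

/-- The cancellation behind the hook identity, in an arbitrary commutative ring. -/
lemma hook_cancellation {R : Type*} [CommRing R]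
    {a a' b b' u u' w w' P P' Q Q' A A0 C' C0' : R}
    (ha : a * a' = 1) (hb : b * b' = 1) (hu : u * u' = 1) (hw : w * w' = 1)
    (hA : A = A0 + (b - 1) * P) (hC : C' = C0' - (a' - 1) * P')
    (h1 : (b - 1) * C0' = u' * b * (1 - w')) (h2 : (a' - 1) * A0 = a' * (1 - u))
    (h3 : A0 * C0' = u' * b * w' * Q) (hQ : Q' = u' * a * w' * b * Q) :
    (A * C' + (u * a' * w * (Q' - P') + u * w * b' * P')) -
        (a * b' * (A * C') + (b * P + a * (Q - P))) =
      (u' * w' * (b - a) * Q + (b - a) * (u' - u' * w' - 1) * P - (b * a' + a - b) * (P * P')) -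
      (u * w * (b' - a') * Q' + (b' - a') * (u - u * w - 1) * P' -
        (b' * a + a' - b') * (P' * P)) := by
  have hAC : A * C' =
      u' * b * w' * Q + u' * b * (1 - w') * P - a' * (1 - u) * P' -
        (b - 1) * (a' - 1) * (P * P') := by
    subst hA hC
    linear_combination h3 + P * h1 - P' * h2
  rw [hAC, hQ]
  clear hAC hA hC h1 h2 h3 hQ
  grind

lemma sum_range_ite_lt {M : Type*} [AddCommMonoid M] {k n : ℕ} (h : k ≤ n) (f : ℕ → M) :
    (∑ y ∈ Finset.range n, if y < k then f y else 0) = ∑ y ∈ Finset.range k, f y := by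
  rw [← Finset.sum_filter]
  congr 1
  ext y
  simp only [Finset.mem_filter, Finset.mem_range]
  omega

/-- Geometric sums of monomials telescope. -/
lemma mono_sub_one_mul_sum (d v : ℤ × ℤ) (k : ℕ) :
    (mono d - 1) * ∑ i ∈ Finset.range k, mono (v + (i : ℤ) • d) =
      mono (v + (k : ℤ) • d) - mono v := by
  rw [Finset.mul_sum, ← sub_eq_zero]
  have : ∀ i : ℕ, (mono d - 1) * mono (v + (i : ℤ) • d) =
      mono (v + ((i + 1 : ℕ) : ℤ) • d) - mono (v + (i : ℤ) • d) := by
    intro i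
    rw [sub_mul, mono_mul, one_mul]
    congr 2
    push_cast
    module
  simp only [this]
  rw [Finset.sum_range_sub fun i : ℕ => mono (v + (i : ℤ) • d)]
  simp

/-- Data of the columns `c` and rows `r` of a partition inside `m^n`: the two families of
differences of boundary steps, completed by the rectangle hooks, have the same formal sum up to an
antisymmetric element. -/
lemma exists_sum_mono_sub_eq (m n : ℕ) (r c : ℕ → ℕ) (hr : ∀ y, r y ≤ m) (hc : ∀ x, c x ≤ n)
    (hrc : ∀ x y, x < r y ↔ y < c x) :
    ∃ X, (∑ p ∈ rect m n, mono ((r p.2 : ℤ) - 1 - p.1, (c p.1 : ℤ) - p.2) +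
        ∑ p ∈ rect m n, mono (if p.1 < r p.2 then ((p.1 : ℤ) + 1, (n : ℤ) - 1 - p.2)
          else ((p.1 : ℤ), (n : ℤ) - p.2))) -
      (∑ p ∈ rect m n, mono ((r p.2 : ℤ) - p.1, (c p.1 : ℤ) - 1 - p.2) +
        ∑ p ∈ rect m n, mono (if p.1 < r p.2 then ((m : ℤ) - 1 - p.1, (p.2 : ℤ) + 1)
          else ((m : ℤ) - p.1, (p.2 : ℤ)))) = X - monoInv X := by
  set P : AddMonoidAlgebra ℤ (ℤ × ℤ) :=
    ∑ p ∈ rect m n, if p.1 < r p.2 then mono ((m : ℤ) - 1 - p.1, (p.2 : ℤ)) else 0 with hP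
  set Q : AddMonoidAlgebra ℤ (ℤ × ℤ) :=
    ∑ p ∈ rect m n, mono ((m : ℤ) - 1 - p.1, (p.2 : ℤ)) with hQ
  have hP' : monoInv P = ∑ p ∈ rect m n,
      if p.1 < r p.2 then mono (1 + (p.1 : ℤ) - m, -(p.2 : ℤ)) else 0 := by
    rw [hP, map_sum]
    refine Finset.sum_congr rfl fun p _ => ?_
    split_ifs
    · rw [monoInv_mono]; congr 1; ext <;> simp <;> ring
    · simp
  have hQ' : monoInv Q = ∑ p ∈ rect m n, mono (1 + (p.1 : ℤ) - m, -(p.2 : ℤ)) := by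
    rw [hQ, map_sum]
    refine Finset.sum_congr rfl fun p _ => ?_
    rw [monoInv_mono]; congr 1; ext <;> simp <;> ring
  have hQrev : monoInv Q = mono (-m, 0) * mono (1, 0) * mono (0, -n) * mono (0, 1) * Q := by
    rw [hQ', hQ, Finset.mul_sum, rect, Finset.sum_product, Finset.sum_product,
      ← Finset.sum_range_reflect]
    refine Finset.sum_congr rfl fun x hx => ?_
    rw [← Finset.sum_range_reflect]
    refine Finset.sum_congr rfl fun y hy => ?_
    rw [Finset.mem_range] at hx hy
    simp only [mono_mul]
    congr 1
    ext <;> simp <;> omega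
  set A : AddMonoidAlgebra ℤ (ℤ × ℤ) :=
    ∑ x ∈ Finset.range m, mono ((m : ℤ) - 1 - x, (c x : ℤ)) with hA
  set A0 : AddMonoidAlgebra ℤ (ℤ × ℤ) :=
    ∑ x ∈ Finset.range m, mono ((m : ℤ) - 1 - x, 0) with hA0
  set C' : AddMonoidAlgebra ℤ (ℤ × ℤ) :=
    ∑ y ∈ Finset.range n, mono ((r y : ℤ) - m, -(y : ℤ)) with hC'
  set C0' : AddMonoidAlgebra ℤ (ℤ × ℤ) :=
    ∑ y ∈ Finset.range n, mono (-(m : ℤ), -(y : ℤ)) with hC0'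
  have eA : A = A0 + (mono (0, 1) - 1) * P := by
    rw [hP, rect, Finset.sum_product, Finset.mul_sum, hA, hA0, ← Finset.sum_add_distrib]
    refine Finset.sum_congr rfl fun x _ => ?_
    simp only [hrc]
    rw [sum_range_ite_lt (hc x) fun y : ℕ => mono ((m : ℤ) - 1 - x, (y : ℤ))]
    have := mono_sub_one_mul_sum (0, 1) ((m : ℤ) - 1 - x, 0) (c x)
    simp only [Prod.smul_mk, Prod.mk_add_mk, smul_eq_mul, mul_zero, mul_one, add_zero,
      zero_add] at this
    rw [this]
    ring
  have eC : C' = C0' - (mono (-1, 0) - 1) * monoInv P := by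
    rw [hP', rect, Finset.sum_product_right, Finset.mul_sum, hC', hC0', ← Finset.sum_sub_distrib]
    refine Finset.sum_congr rfl fun y _ => ?_
    rw [sum_range_ite_lt (hr y) fun x : ℕ => mono (1 + (x : ℤ) - m, -(y : ℤ)),
      ← Finset.sum_range_reflect]
    have hd := mono_sub_one_mul_sum (-1, 0) ((r y : ℤ) - m, -(y : ℤ)) (r y)
    simp only [Prod.smul_mk, Prod.mk_add_mk, smul_eq_mul, mul_zero, mul_neg, mul_one, add_zero,
      show (r y : ℤ) - m + -(r y : ℤ) = -m by ring] at hd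
    have hs : ∑ j ∈ Finset.range (r y), mono (1 + ((r y - 1 - j : ℕ) : ℤ) - m, -(y : ℤ)) =
        ∑ i ∈ Finset.range (r y), mono ((r y : ℤ) - m + -(i : ℤ), -(y : ℤ)) := by
      refine Finset.sum_congr rfl fun j hj => ?_
      rw [Finset.mem_range] at hj
      congr 2
      omega
    rw [hs, hd]
    ring
  have e1 : (mono (0, 1) - 1) * C0' = mono (-m, 0) * mono (0, 1) * (1 - mono (0, -n)) := by
    have hd := mono_sub_one_mul_sum (0, 1) (-(m : ℤ), 1 - (n : ℤ)) n
    simp only [Prod.smul_mk, Prod.mk_add_mk, smul_eq_mul, mul_zero, mul_one, add_zero,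
      sub_add_cancel] at hd
    have hs : C0' = ∑ i ∈ Finset.range n, mono (-(m : ℤ), 1 - (n : ℤ) + i) := by
      rw [hC0', ← Finset.sum_range_reflect]
      refine Finset.sum_congr rfl fun j hj => ?_
      rw [Finset.mem_range] at hj
      congr 2
      omega
    rw [hs, hd, mul_sub, mul_one, mono_mul, mono_mul]
    simp [sub_eq_add_neg]
  have e2 : (mono (-1, 0) - 1) * A0 = mono (-1, 0) * (1 - mono (m, 0)) := by
    have hd := mono_sub_one_mul_sum (-1, 0) ((m : ℤ) - 1, 0) m
    simp only [Prod.smul_mk, Prod.mk_add_mk, smul_eq_mul, mul_zero, mul_neg, mul_one, add_zero,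
      ← sub_eq_add_neg, sub_sub_cancel_left] at hd
    rw [hA0, hd, mul_sub, mul_one, mono_mul]
    congr 2
  have e3 : A0 * C0' = mono (-m, 0) * mono (0, 1) * mono (0, -n) * Q := by
    rw [hA0, hC0', hQ, Finset.sum_mul_sum, rect, Finset.sum_product, Finset.mul_sum]
    refine Finset.sum_congr rfl fun x _ => ?_
    rw [Finset.mul_sum, ← Finset.sum_range_reflect]
    refine Finset.sum_congr rfl fun y hy => ?_
    rw [Finset.mem_range] at hy
    simp only [mono_mul]
    congr 1
    ext <;> simp <;> omega
  have eAC : A * C' = ∑ p ∈ rect m n, mono ((r p.2 : ℤ) - 1 - p.1, (c p.1 : ℤ) - p.2) := by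
    rw [hA, hC', Finset.sum_mul_sum, rect, Finset.sum_product]
    refine Finset.sum_congr rfl fun x _ => Finset.sum_congr rfl fun y _ => ?_
    rw [mono_mul]; congr 1; ext <;> simp <;> ring
  have eAC' : mono (1, 0) * mono (0, -1) * (A * C') =
      ∑ p ∈ rect m n, mono ((r p.2 : ℤ) - p.1, (c p.1 : ℤ) - 1 - p.2) := by
    rw [eAC, Finset.mul_sum]
    refine Finset.sum_congr rfl fun p _ => ?_
    rw [mono_mul, mono_mul]; congr 1; ext <;> simp <;> ring
  have eD : mono (m, 0) * mono (-1, 0) * mono (0, n) * (monoInv Q - monoInv P) +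
      mono (m, 0) * mono (0, n) * mono (0, -1) * monoInv P =
      ∑ p ∈ rect m n, mono (if p.1 < r p.2 then ((p.1 : ℤ) + 1, (n : ℤ) - 1 - p.2)
          else ((p.1 : ℤ), (n : ℤ) - p.2)) := by
    rw [hQ', hP', ← Finset.sum_sub_distrib, Finset.mul_sum, Finset.mul_sum,
      ← Finset.sum_add_distrib]
    refine Finset.sum_congr rfl fun p _ => ?_
    split_ifs
    · simp only [sub_self, mul_zero, zero_add, mono_mul]; congr 1; ext <;> simp <;> ring
    · simp only [sub_zero, mul_zero, add_zero, mono_mul]; congr 1; ext <;> simp <;> ring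
  have eD' : mono (0, 1) * P + mono (1, 0) * (Q - P) =
      ∑ p ∈ rect m n, mono (if p.1 < r p.2 then ((m : ℤ) - 1 - p.1, (p.2 : ℤ) + 1)
          else ((m : ℤ) - p.1, (p.2 : ℤ))) := by
    rw [hQ, hP, ← Finset.sum_sub_distrib, Finset.mul_sum, Finset.mul_sum,
      ← Finset.sum_add_distrib]
    refine Finset.sum_congr rfl fun p _ => ?_
    split_ifs
    · simp only [sub_self, mul_zero, add_zero, mono_mul]; congr 1; ext <;> simp <;> ring
    · simp only [sub_zero, mul_zero, zero_add, mono_mul]; congr 1; ext <;> simp <;> ring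
  rw [← eAC', ← eAC, ← eD, ← eD', hook_cancellation (a' := mono (-1, 0)) (b' := mono (0, -1))
    (u' := mono (-m, 0)) (w' := mono (0, -n)) ?_ ?_ ?_ ?_ eA eC e1 e2 e3 hQrev]
  · refine ⟨_, congrArg₂ _ rfl ?_⟩
    simp only [map_add, map_sub, map_mul, map_one, monoInv_mono, monoInv_monoInv, Prod.neg_mk, neg_neg,
      neg_zero]
  all_goals
    rw [mono_mul, ← mono_zero]
    exact congrArg mono (by ext <;> simp)

lemma brk_ne_zero {c : ℤ × ℤ} (hc : c ≠ 0) : brk c ≠ 0 := by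
  intro h
  apply hc
  have h' : algebraMap (Polynomial ℚ) K
      (Polynomial.X * Polynomial.C (c.1 : ℚ) - Polynomial.C (c.2 : ℚ)) = 0 := by
    rw [← h, brk, alpha]
    simp
  rw [map_eq_zero_iff _ (RatFunc.algebraMap_injective ℚ)] at h'
  have h0 := congrArg (fun p => Polynomial.coeff p 0) h'
  have h1 := congrArg (fun p => Polynomial.coeff p 1) h'
  simp only [Polynomial.coeff_sub, Polynomial.mul_coeff_zero, Polynomial.coeff_X_zero, zero_mul,
    Polynomial.coeff_C_zero, Polynomial.coeff_zero, zero_sub, neg_eq_zero, Int.cast_eq_zero] at h0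
  simp only [Polynomial.coeff_mul_C, Polynomial.coeff_X_one, one_mul, h0,
    Int.cast_zero, map_zero, Polynomial.coeff_zero, sub_zero, Int.cast_eq_zero] at h1
  ext <;> assumption

lemma brk_neg (c : ℤ × ℤ) : brk (-c) = -brk c := by
  simp [brk]; ring

/-- The nonnegative linear forms `αi + j` extend to an even, nowhere vanishing function on `ℤ²`. -/
lemma exists_even_extension : ∃ G : ℤ × ℤ → Kˣ, (∀ v, G (-v) = G v) ∧
    ∀ i j : ℤ, 0 ≤ i → 0 ≤ j → 0 < i + j → (G (i, j) : K) = brk (i, -j) := by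
  have hne : ∀ v : ℤ × ℤ, v ≠ 0 → brk (v.1, -v.2) ≠ 0 := by
    intro v hv
    refine brk_ne_zero fun h => hv ?_
    simpa [Prod.ext_iff] using h
  refine ⟨fun v => if hv : v = 0 then 1 else if 0 < v.1 ∨ v.1 = 0 ∧ 0 < v.2 then
    Units.mk0 _ (hne v hv) else -Units.mk0 _ (hne v hv), ?_, ?_⟩
  · rintro ⟨i, j⟩
    by_cases h0 : ((i, j) : ℤ × ℤ) = 0
    · simp [h0]
    · have h0' : (-(i, j) : ℤ × ℤ) ≠ 0 := neg_ne_zero.2 h0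
      have hb : brk (-i, j) = -brk (i, -j) := by simpa using brk_neg (i, -j)
      have hij : ¬ (i = 0 ∧ j = 0) := by simpa [Prod.ext_iff] using h0
      beta_reduce
      rw [dif_neg h0, dif_neg h0']
      ext
      simp only [Prod.fst_neg, Prod.snd_neg]
      split_ifs
      · omega
      · simp [hb]
      · simp [hb]
      · omega
  · intro i j hi hj hij
    have h0 : ((i, j) : ℤ × ℤ) ≠ 0 := by
      simp only [ne_eq, Prod.ext_iff, Prod.fst_zero, Prod.snd_zero]
      omega
    have hpos : 0 < i ∨ i = 0 ∧ 0 < j := by omega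
    simp only [dif_neg h0, if_pos hpos, Units.val_mk0]

lemma arm_eq {S : Finset Box} {s : Box} {k : ℕ} (h : ∀ x, (x, s.2) ∈ S ↔ x < k) :
    arm S s = k - (s.1 + 1) := by
  have : (S.filter fun b => b.2 = s.2 ∧ s.1 < b.1) = Finset.Ico (s.1 + 1) k ×ˢ {s.2} := by
    ext ⟨x, y⟩
    simp only [Finset.mem_filter, Finset.mem_product, Finset.mem_Ico, Finset.mem_singleton]
    constructor
    · rintro ⟨h1, rfl, h2⟩
      exact ⟨⟨h2, (h x).1 h1⟩, rfl⟩
    · rintro ⟨⟨h1, h2⟩, rfl⟩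
      exact ⟨(h x).2 h2, rfl, h1⟩
  rw [arm, this]
  simp

lemma leg_eq {S : Finset Box} {s : Box} {k : ℕ} (h : ∀ y, (s.1, y) ∈ S ↔ y < k) :
    leg S s = k - (s.2 + 1) := by
  have : (S.filter fun b => b.1 = s.1 ∧ s.2 < b.2) = {s.1} ×ˢ Finset.Ico (s.2 + 1) k := by
    ext ⟨x, y⟩
    simp only [Finset.mem_filter, Finset.mem_product, Finset.mem_Ico, Finset.mem_singleton]
    constructor
    · rintro ⟨h1, rfl, h2⟩
      exact ⟨rfl, h2, (h y).1 h1⟩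
    · rintro ⟨rfl, h1, h2⟩
      exact ⟨(h y).2 h2, rfl, h1⟩
  rw [leg, this]
  simp

lemma mem_rect {m n : ℕ} {b : Box} : b ∈ rect m n ↔ b.1 < m ∧ b.2 < n := by
  simp [rect]

/-- A Young diagram inside `m^n` is described by its row lengths and its column lengths. -/
lemma exists_row_col {m n : ℕ} {S : Finset Box} (hS : IsYoung S) (hsub : S ⊆ rect m n) :
    ∃ r c : ℕ → ℕ, (∀ y, r y ≤ m) ∧ (∀ x, c x ≤ n) ∧
      (∀ x y, (x, y) ∈ S ↔ x < r y) ∧ ∀ x y, (x, y) ∈ S ↔ y < c x := by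
  have hx : ∀ y, (m, y) ∉ S := fun y h => absurd (mem_rect.1 (hsub h)).1 (lt_irrefl m)
  have hy : ∀ x, (x, n) ∉ S := fun x h => absurd (mem_rect.1 (hsub h)).2 (lt_irrefl n)
  refine ⟨fun y => Nat.find (p := fun x => (x, y) ∉ S) ⟨m, hx y⟩,
    fun x => Nat.find (p := fun y => (x, y) ∉ S) ⟨n, hy x⟩, fun y => Nat.find_min' _ (hx y),
    fun x => Nat.find_min' _ (hy x), fun x y => ?_, fun x y => ?_⟩
  · rw [Nat.lt_find_iff]
    exact ⟨fun h x' hx' => not_not.2 (hS (show ((x', y) : Box) ≤ (x, y) from ⟨hx', le_rfl⟩) h),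
      fun h => not_not.1 (h x le_rfl)⟩
  · rw [Nat.lt_find_iff]
    exact ⟨fun h y' hy' => not_not.2 (hS (show ((x, y') : Box) ≤ (x, y) from ⟨le_rfl, hy'⟩) h),
      fun h => not_not.1 (h y le_rfl)⟩

lemma mem_complIn {m n : ℕ} {S : Finset Box} {b : Box} :
    b ∈ complIn m n S ↔ b ∈ rect m n ∧ conjBox m n b ∉ S := by
  simp only [complIn, Finset.mem_image, Finset.mem_sdiff, mem_rect]
  constructor
  · rintro ⟨⟨x, y⟩, ⟨⟨hx, hy⟩, h⟩, rfl⟩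
    dsimp only at hx hy
    refine ⟨⟨by dsimp [conjBox]; omega, by dsimp [conjBox]; omega⟩, ?_⟩
    rwa [show conjBox m n (conjBox m n (x, y)) = (x, y) by ext <;> dsimp [conjBox] <;> omega]
  · rintro ⟨⟨hx, hy⟩, h⟩
    refine ⟨conjBox m n b, ⟨⟨by dsimp [conjBox]; omega, by dsimp [conjBox]; omega⟩, h⟩, ?_⟩
    ext <;> dsimp [conjBox] <;> omega

lemma prod_complIn {M : Type*} [CommMonoid M] (m n : ℕ) (S : Finset Box) (f : Box → M) :
    ∏ b ∈ complIn m n S, f b = ∏ b ∈ rect m n \ S, f (conjBox m n b) := by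
  refine Finset.prod_image fun p hp q hq h => ?_
  simp only [Finset.coe_sdiff, Set.mem_sdiff, Finset.mem_coe, mem_rect] at hp hq
  simp only [conjBox, Prod.mk.injEq] at h
  ext <;> omega

lemma arm_rect_s3 {m n : ℕ} {b : Box} (hb : b ∈ rect m n) : arm (rect m n) b = m - (b.1 + 1) :=
  arm_eq fun x => by simp [mem_rect, (mem_rect.1 hb).2]

lemma leg_rect_s3 {m n : ℕ} {b : Box} (hb : b ∈ rect m n) : leg (rect m n) b = n - (b.2 + 1) :=
  leg_eq fun y => by simp [mem_rect, (mem_rect.1 hb).1]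

lemma arm_complIn {m n : ℕ} {S : Finset Box} {r : ℕ → ℕ} (hr : ∀ y, r y ≤ m)
    (h : ∀ x y, (x, y) ∈ S ↔ x < r y) {b : Box} (hb : b ∈ rect m n) :
    arm (complIn m n S) (conjBox m n b) = b.1 - r b.2 := by
  rw [mem_rect] at hb
  have hrb := hr b.2
  rw [arm_eq (k := m - r b.2)]
  · dsimp [conjBox]; omega
  · intro x
    rw [mem_complIn, mem_rect]
    simp only [conjBox, h]
    rw [show n - 1 - (n - 1 - b.2) = b.2 by omega]
    omega

lemma leg_complIn {m n : ℕ} {S : Finset Box} {c : ℕ → ℕ} (hc : ∀ x, c x ≤ n)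
    (h : ∀ x y, (x, y) ∈ S ↔ y < c x) {b : Box} (hb : b ∈ rect m n) :
    leg (complIn m n S) (conjBox m n b) = b.2 - c b.1 := by
  rw [mem_rect] at hb
  have hcb := hc b.1
  rw [leg_eq (k := n - c b.1)]
  · dsimp [conjBox]; omega
  · intro y
    rw [mem_complIn, mem_rect]
    simp only [conjBox, h]
    rw [show m - 1 - (m - 1 - b.1) = b.1 by omega]
    omega

lemma prod_vflip {M : Type*} [CommMonoid M] (m n : ℕ) (f : Box → M) :
    ∏ b ∈ rect m n, f b = ∏ b ∈ rect m n, f (vflip n b) := by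
  rw [rect, Finset.prod_product, Finset.prod_product]
  refine Finset.prod_congr rfl fun x _ => ?_
  rw [← Finset.prod_range_reflect]
  rfl

lemma prod_hflip {M : Type*} [CommMonoid M] (m n : ℕ) (f : Box → M) :
    ∏ b ∈ rect m n, f b = ∏ b ∈ rect m n, f (hflip m b) := by
  rw [rect, Finset.prod_product_right, Finset.prod_product_right]
  refine Finset.prod_congr rfl fun y _ => ?_
  rw [← Finset.prod_range_reflect]
  rfl

/-- The two hook-product presentations of the rectangular
Littlewood–Richardson coefficient agree. -/
theorem stmt3 (m n : ℕ) (hm : 1 ≤ m) (hn : 1 ≤ n) (μ : Finset Box)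
    (hμ : IsYoung μ) (hsub : μ ⊆ rect m n) :
    (∏ b ∈ μ, lh μ b) * (∏ b ∈ complIn m n μ, uh (complIn m n μ) b) *
        (∏ b ∈ rect m n, Dp m n (complIn m n μ) b) =
      (∏ b ∈ μ, uh μ b) * (∏ b ∈ complIn m n μ, lh (complIn m n μ) b) *
        (∏ b ∈ rect m n, Dp m n μ b) := by
  obtain ⟨r, c, hr, hc, hmr, hmc⟩ := exists_row_col hμ hsub
  obtain ⟨G, hG, hGv⟩ := exists_even_extension
  have hrc : ∀ x y, x < r y ↔ y < c x := fun x y => (hmr x y).symm.trans (hmc x y)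
  have hval : ∀ {v w : ℤ × ℤ}, 0 ≤ v.1 → 0 ≤ v.2 → 0 < v.1 + v.2 → w = (v.1, -v.2) →
      brk w = (G v : K) := fun h1 h2 h3 h => by rw [h]; exact (hGv _ _ h1 h2 h3).symm
  have hval' : ∀ {v w : ℤ × ℤ}, v.1 ≤ 0 → v.2 ≤ 0 → v.1 + v.2 < 0 → w = (-v.1, v.2) →
      brk w = (G v : K) := fun {v w} h1 h2 h3 h => by
    rw [← hG]
    exact hval (by simpa using h1) (by simpa using h2) (by simp; omega) (by simpa using h)
  have harm : ∀ b, arm μ b = r b.2 - (b.1 + 1) := fun b => arm_eq fun x => hmr x b.2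
  have hleg : ∀ b, leg μ b = c b.1 - (b.2 + 1) := fun b => leg_eq fun y => hmc b.1 y
  have e1 : (∏ b ∈ μ, lh μ b) * (∏ b ∈ complIn m n μ, uh (complIn m n μ) b) =
      ∏ b ∈ rect m n, (G ((r b.2 : ℤ) - 1 - b.1, (c b.1 : ℤ) - b.2) : K) := by
    rw [prod_complIn, mul_comm, ← Finset.prod_sdiff hsub]
    congr 1
    · refine Finset.prod_congr rfl fun b hb => ?_
      rw [Finset.mem_sdiff] at hb
      have h1 := mt (hmr b.1 b.2).2 hb.2
      have h2 := mt (hmc b.1 b.2).2 hb.2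
      rw [uh, hup, arm_complIn hr hmr hb.1, leg_complIn hc hmc hb.1]
      exact hval' (by dsimp; omega) (by dsimp; omega) (by dsimp; omega)
        (by ext <;> dsimp <;> omega)
    · refine Finset.prod_congr rfl fun b hb => ?_
      have h1 := (hmr b.1 b.2).1 hb
      have h2 := (hmc b.1 b.2).1 hb
      rw [lh, hlo, harm, hleg]
      exact hval (by dsimp; omega) (by dsimp; omega) (by dsimp; omega)
        (by ext <;> dsimp <;> omega)
  have e2 : (∏ b ∈ μ, uh μ b) * (∏ b ∈ complIn m n μ, lh (complIn m n μ) b) =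
      ∏ b ∈ rect m n, (G ((r b.2 : ℤ) - b.1, (c b.1 : ℤ) - 1 - b.2) : K) := by
    rw [prod_complIn, mul_comm, ← Finset.prod_sdiff hsub]
    congr 1
    · refine Finset.prod_congr rfl fun b hb => ?_
      rw [Finset.mem_sdiff] at hb
      have h1 := mt (hmr b.1 b.2).2 hb.2
      have h2 := mt (hmc b.1 b.2).2 hb.2
      rw [lh, hlo, arm_complIn hr hmr hb.1, leg_complIn hc hmc hb.1]
      exact hval' (by dsimp; omega) (by dsimp; omega) (by dsimp; omega)
        (by ext <;> dsimp <;> omega)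
    · refine Finset.prod_congr rfl fun b hb => ?_
      have h1 := (hmr b.1 b.2).1 hb
      have h2 := (hmc b.1 b.2).1 hb
      rw [uh, hup, harm, hleg]
      exact hval (by dsimp; omega) (by dsimp; omega) (by dsimp; omega)
        (by ext <;> dsimp <;> omega)
  have e3 : ∏ b ∈ rect m n, Dp m n (complIn m n μ) b =
      ∏ b ∈ rect m n, (G (if b.1 < r b.2 then ((b.1 : ℤ) + 1, (n : ℤ) - 1 - b.2)
          else ((b.1 : ℤ), (n : ℤ) - b.2)) : K) := by
    rw [prod_hflip]
    refine Finset.prod_congr rfl fun b hb => ?_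
    have hb' := mem_rect.1 hb
    have hf : hflip m b ∈ rect m n := mem_rect.2 ⟨by dsimp [hflip]; omega, hb'.2⟩
    have hmem : vflip n (hflip m b) ∈ complIn m n μ ↔ ¬ b.1 < r b.2 := by
      rw [mem_complIn, ← hmr, show conjBox m n (vflip n (hflip m b)) = b by
        ext <;> dsimp [conjBox, vflip, hflip] <;> omega, and_iff_right]
      exact mem_rect.2 ⟨by dsimp [vflip, hflip]; omega, by dsimp [vflip, hflip]; omega⟩
    simp only [Dp, hmem, lh, hlo, uh, hup, arm_rect_s3 hf, leg_rect_s3 hf, ite_not]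
    split_ifs <;>
    exact hval (by dsimp; omega) (by dsimp; omega) (by dsimp; omega)
      (by ext <;> dsimp [hflip] <;> omega)
  have e4 : ∏ b ∈ rect m n, Dp m n μ b =
      ∏ b ∈ rect m n, (G (if b.1 < r b.2 then ((m : ℤ) - 1 - b.1, (b.2 : ℤ) + 1)
          else ((m : ℤ) - b.1, (b.2 : ℤ))) : K) := by
    rw [prod_vflip]
    refine Finset.prod_congr rfl fun b hb => ?_
    have hb' := mem_rect.1 hb
    have hf : vflip n b ∈ rect m n := mem_rect.2 ⟨hb'.1, by dsimp [vflip]; omega⟩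
    have hmem : vflip n (vflip n b) ∈ μ ↔ b.1 < r b.2 := by
      rw [← hmr, show vflip n (vflip n b) = b by ext <;> dsimp [vflip]; omega]
    simp only [Dp, hmem, lh, hlo, uh, hup, arm_rect_s3 hf, leg_rect_s3 hf]
    split_ifs <;>
    exact hval (by dsimp; omega) (by dsimp; omega) (by dsimp; omega)
      (by ext <;> dsimp [vflip] <;> omega)
  obtain ⟨X, hX⟩ := exists_sum_mono_sub_eq m n r c hr hc hrc
  rw [e1, e2, e3, e4]
  exact_mod_cast congrArg Units.val (prod_eq_of_sum_mono hG _ _ _ _ _ X hX)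

end JackLR
end
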